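/- Let a : ℕ → ℝ be nonnegative and summable, N(τ) := ∑'_j a_j/(a_j+τ), and let τ > 0. Let g : ℝ → ℝ satisfy t·|g(t)| ≤ γ₀ and τ·|g(t)| ≤ γ_* for all t ≥ 0, where γ₀, γ_* > 0. Then: (i) ∑'_j ( g(a_j)·a_j )² ≤ (γ₀ + γ_*)·γ₀·N(τ); and (ii) sup_j ( g(a_j)·a_j )² ≤ γ₀². (Multiplying by σ², (i) and (ii) bound the variance S̃_τ² and weak variance ṽ_τ² of the reconstruction T̃R_τ = g_τ(TT*)TT* used for the direct testing problem: S̃_τ² ≤ (γ₀+γ_*)γ₀·σ²·N(τ) and ṽ_τ² ≤ σ²·γ₀².) -/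

import Mathlib

/-- The terms of the effective dimension are summable. -/
theorem summable_div_add_const {a : ℕ → ℝ} (ha : ∀ j, 0 ≤ a j) (hsum : Summable a)
    {τ : ℝ} (hτ : 0 < τ) : Summable fun j => a j / (a j + τ) := by
  refine Summable.of_nonneg_of_le (fun j => ?_) (fun j => ?_) (hsum.div_const τ)
  · have := ha j
    positivity
  · exact div_le_div_of_nonneg_left (ha j) hτ (by linarith [ha j])

/-- Termwise bound on the squared singular values of the direct reconstruction. -/
theorem sq_mul_le_mul_div_add {t τ x γ₀ γs : ℝ} (ht : 0 ≤ t) (hτ : 0 < τ)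
    (h0 : t * |x| ≤ γ₀) (hs : τ * |x| ≤ γs) :
    (x * t) ^ 2 ≤ (γ₀ + γs) * γ₀ * (t / (t + τ)) := by
  have hpos : 0 < t + τ := by linarith
  have hnn : 0 ≤ t * |x| := by positivity
  have hle : t * |x| ≤ (γ₀ + γs) * (t / (t + τ)) := by
    rw [← mul_div_assoc, le_div_iff₀ hpos]
    nlinarith [mul_le_mul_of_nonneg_left (add_le_add h0 hs) ht]
  calc (x * t) ^ 2 = (t * |x|) * (t * |x|) := by
        rw [mul_pow, ← sq_abs x]
        ring
    _ ≤ γ₀ * ((γ₀ + γs) * (t / (t + τ))) :=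
        mul_le_mul h0 hle hnn (hnn.trans h0)
    _ = (γ₀ + γs) * γ₀ * (t / (t + τ)) := by ring

/-- Variance and weak-variance bounds for the direct reconstruction
`g_τ(TT*)TT*` (singular values `g(a_j) a_j`): if `t|g(t)| ≤ γ₀` and
`τ|g(t)| ≤ γ_*` for all `t ≥ 0`, then `∑' (g(a_j) a_j)² ≤ (γ₀+γ_*)γ₀ N(τ)` and
`sup_j (g(a_j) a_j)² ≤ γ₀²`, where `N(τ) = ∑' a_j/(a_j+τ)`. -/
theorem stmt_11
    (a : ℕ → ℝ) (ha : ∀ j, 0 ≤ a j) (hsum : Summable a)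
    (τ : ℝ) (hτ : 0 < τ)
    (g : ℝ → ℝ) (γ₀ γs : ℝ) (hγ₀ : 0 < γ₀) (hγs : 0 < γs)
    (hg0 : ∀ t : ℝ, 0 ≤ t → t * |g t| ≤ γ₀)
    (hgs : ∀ t : ℝ, 0 ≤ t → τ * |g t| ≤ γs)
    (N : ℝ) (hN : N = ∑' j, a j / (a j + τ)) :
    (∑' j, (g (a j) * a j) ^ 2) ≤ (γ₀ + γs) * γ₀ * N ∧
      (⨆ j, (g (a j) * a j) ^ 2) ≤ γ₀ ^ 2 := by
  have hbound : ∀ j, (g (a j) * a j) ^ 2 ≤ (γ₀ + γs) * γ₀ * (a j / (a j + τ)) := fun j =>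
    sq_mul_le_mul_div_add (ha j) hτ (hg0 _ (ha j)) (hgs _ (ha j))
  have hmajorant := (summable_div_add_const ha hsum hτ).mul_left ((γ₀ + γs) * γ₀)
  constructor
  · rw [hN, ← tsum_mul_left]
    exact (Summable.of_nonneg_of_le (fun j => sq_nonneg _) hbound hmajorant).tsum_le_tsum
      hbound hmajorant
  · refine ciSup_le fun j => sq_le_sq' ?_ ?_ <;>
      have h := hg0 _ (ha j) <;>
      rw [← abs_of_nonneg (ha j), ← abs_mul, abs_of_nonneg (ha j), mul_comm] at h
    · exact (abs_le.mp h).1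
    · exact (abs_le.mp h).2
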